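/- Let k ≥ 1 be an odd integer, N_e ≥ 1 an integer, l ∈ ℤ, and τ ∈ ℂ with Im τ > 0. For x_j, y_j ∈ ℝ set z_j := x_j + τy_j (j = 1,…,N_e), Z := Σ_{j=1}^{N_e} z_j, and define the Laughlin wavefunction Ψ_L(x₁,y₁,…,x_{N_e},y_{N_e}) := ϑ[(N_e−1)/(2k) + l/k, (N_e−1)/2](kZ, kτ)·∏_{1≤i<j≤N_e} (θ₁₁(z_i − z_j, τ))^k·exp(iπτkN_e·Σ_{j=1}^{N_e} y_j²). Then for all integers a, b, replacing (x₁, y₁) by (x₁+a, y₁+b) while keeping the remaining variables fixed multiplies Ψ_L by exp(−2πikN_e b x₁): Ψ_L(x₁+a, y₁+b, x₂, y₂, …) = exp(−2πikN_e b x₁)·Ψ_L(x₁, y₁, x₂, y₂, …). (That is, the Laughlin state at filling fraction 1/k transforms in each particle with the unitary multipliers of the degree-kN_e line bundle over the torus ℂ/(ℤ ⊕ τℤ).) -/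

import Mathlib

open scoped BigOperators

/-- Theta function with characteristics `α, β`:
`ϑ[α,β](w,σ) = Σ_{n∈ℤ} exp(iπσ(n+α)² + 2πi(n+α)(w+β))`. -/
noncomputable def jtheta2 (α β : ℝ) (w σ : ℂ) : ℂ :=
  ∑' n : ℤ, Complex.exp (Real.pi * Complex.I * σ * ((n : ℂ) + (α : ℂ)) ^ 2 +
    2 * Real.pi * Complex.I * ((n : ℂ) + (α : ℂ)) * (w + (β : ℂ)))

/-- `θ₁₁(w,σ) = ϑ[1/2,1/2](w,σ)`. -/
noncomputable def theta11 (w σ : ℂ) : ℂ := jtheta2 (1/2) (1/2) w σ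

/-- The Laughlin wavefunction at filling fraction `1/k`:
`Ψ_L = ϑ[(N_e−1)/(2k)+l/k, (N_e−1)/2](kZ, kτ)·∏_{i<j} θ₁₁(z_i − z_j, τ)^k·e^{iπτkN_e Σ y_j²}`,
with `z_j = x_j + τ y_j` and `Z = Σ z_j`. -/
noncomputable def PsiLaughlin (k Ne : ℕ) (l : ℤ) (τ : ℂ) (x y : Fin Ne → ℝ) : ℂ :=
  jtheta2 (((Ne : ℝ) - 1) / (2 * k) + (l : ℝ) / k) (((Ne : ℝ) - 1) / 2)
      ((k : ℂ) * ∑ j, ((x j : ℂ) + τ * (y j : ℂ))) ((k : ℂ) * τ) *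
    (∏ p ∈ Finset.univ.filter (fun p : Fin Ne × Fin Ne => p.1 < p.2),
      (theta11 (((x p.1 : ℂ) + τ * (y p.1 : ℂ)) - ((x p.2 : ℂ) + τ * (y p.2 : ℂ))) τ) ^ k) *
    Complex.exp (Real.pi * Complex.I * τ * (k : ℂ) * (Ne : ℂ) * ∑ j, (y j : ℂ) ^ 2)


theorem jtheta2_shift (α β : ℝ) (w σ : ℂ) (a b : ℤ) :
    jtheta2 α β (w + a + b * σ) σ =
      Complex.exp (2 * Real.pi * Complex.I * α * a - Real.pi * Complex.I * σ * b ^ 2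
        - 2 * Real.pi * Complex.I * b * (w + β)) * jtheta2 α β w σ := by
  unfold jtheta2
  rw [← tsum_mul_left, ← (Equiv.addRight b).tsum_eq (fun n : ℤ => Complex.exp (2 * Real.pi * Complex.I * α * a - Real.pi * Complex.I * σ * b ^ 2
        - 2 * Real.pi * Complex.I * b * (w + β)) * Complex.exp (Real.pi * Complex.I * σ * ((n : ℂ) + (α : ℂ)) ^ 2 +
    2 * Real.pi * Complex.I * ((n : ℂ) + (α : ℂ)) * (w + (β : ℂ))))]
  congr 1
  ext n
  rw [← Complex.exp_add, Complex.exp_eq_exp_iff_exists_int]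
  refine ⟨n * a, ?_⟩
  simp only [Equiv.coe_addRight]
  push_cast
  ring

theorem sum_pairs (m : ℕ) (c : Fin (m + 1) → ℂ) :
    ∑ p ∈ Finset.univ.filter (fun p : Fin (m + 1) × Fin (m + 1) => p.1 < p.2),
      (if p.1 = 0 then c p.2 else 0) = ∑ j : Fin m, c j.succ := by
  rw [Finset.sum_filter, Fintype.sum_prod_type, Fin.sum_univ_succ]
  simp [Fin.sum_univ_succ, Fin.succ_ne_zero]

theorem laughlin_shift (k m : ℕ) (hk : 1 ≤ k) (hkodd : Odd k) (l : ℤ)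
    (τ : ℂ) (a b : ℤ) (x y : Fin (m + 1) → ℝ) :
      PsiLaughlin k (m + 1) l τ (Function.update x 0 (x 0 + a))
          (Function.update y 0 (y 0 + b)) =
        Complex.exp (-2 * Real.pi * Complex.I * (k : ℂ) * ((m + 1 : ℕ) : ℂ) * (b : ℂ) *
            (x 0 : ℂ)) *
          PsiLaughlin k (m + 1) l τ x y := by
  set z : Fin (m + 1) → ℂ := fun j => (x j : ℂ) + τ * (y j : ℂ) with hz
  have hk0 : (k : ℂ) ≠ 0 := by exact_mod_cast (by omega : k ≠ 0)
  set c : Fin (m + 1) → ℂ := fun j => (k : ℂ) * (Real.pi * Complex.I * a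
    - Real.pi * Complex.I * τ * b ^ 2 - 2 * Real.pi * Complex.I * b * (z 0 - z j + 1 / 2)) with hc
  have h2 : (∏ p ∈ Finset.univ.filter (fun p : Fin (m + 1) × Fin (m + 1) => p.1 < p.2),
      (theta11 ((((Function.update x 0 (x 0 + a)) p.1 : ℝ) + τ * ((Function.update y 0 (y 0 + b) p.1 : ℝ) : ℂ)) - (((Function.update x 0 (x 0 + a)) p.2 : ℝ) + τ * ((Function.update y 0 (y 0 + b)) p.2 : ℝ))) τ) ^ k)
      = Complex.exp (∑ j : Fin m, c j.succ) *
      (∏ p ∈ Finset.univ.filter (fun p : Fin (m + 1) × Fin (m + 1) => p.1 < p.2),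
      (theta11 (((x p.1 : ℂ) + τ * (y p.1 : ℂ)) - ((x p.2 : ℂ) + τ * (y p.2 : ℂ))) τ) ^ k) := by
    rw [← sum_pairs, Complex.exp_sum, ← Finset.prod_mul_distrib]
    refine Finset.prod_congr rfl ?_
    rintro ⟨i, j⟩ hij
    simp only [Finset.mem_filter, Finset.mem_univ, true_and] at hij
    have hj : j ≠ 0 := by rintro rfl; exact absurd hij (Fin.not_lt_zero _)
    by_cases hi : i = 0
    · subst hi
      simp only [Function.update_self, Function.update_of_ne hj, if_true, hc]
      rw [Complex.exp_nat_mul, ← mul_pow]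
      congr 1
      unfold theta11
      have := jtheta2_shift (1/2) (1/2) (z 0 - z j) τ a b
      simp only [hz] at this ⊢
      convert this using 2
      · push_cast; ring
      · push_cast; ring_nf
    · simp [Function.update_of_ne hj, Function.update_of_ne hi, hi]
  have h1 := jtheta2_shift ((((m + 1 : ℕ) : ℝ) - 1) / (2 * k) + (l : ℝ) / k) ((((m + 1 : ℕ) : ℝ) - 1) / 2)
      ((k : ℂ) * ∑ j, ((x j : ℂ) + τ * (y j : ℂ))) ((k : ℂ) * τ) (k * a) b
  unfold PsiLaughlin
  rw [h2]
  have h3 : (k : ℂ) * ∑ j, (((Function.update x 0 (x 0 + a)) j : ℝ) + τ * ((Function.update y 0 (y 0 + b) j : ℝ) : ℂ))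
     = ((k : ℂ) * ∑ j, ((x j : ℂ) + τ * (y j : ℂ))) + ((k * a : ℤ) : ℂ) + b * (k * τ) := by
    rw [Fin.sum_univ_succ, Fin.sum_univ_succ]
    simp [Fin.succ_ne_zero]
    ring
  have h4 : ∑ j, ((Function.update y 0 (y 0 + b) j : ℝ) : ℂ) ^ 2 = ∑ j, (y j : ℂ) ^ 2 + 2 * b * y 0 + b ^ 2 := by
    rw [Fin.sum_univ_succ, Fin.sum_univ_succ]
    simp [Fin.succ_ne_zero]
    ring
  rw [h3, h1, h4]
  have h5 : ∑ j : Fin m, c j.succ = (k : ℂ) * (m * (Real.pi * Complex.I * a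
    - Real.pi * Complex.I * τ * b ^ 2 - 2 * Real.pi * Complex.I * b * (z 0 + 1 / 2))
      + 2 * Real.pi * Complex.I * b * ∑ j : Fin m, z j.succ) := by
    simp only [hc]
    have e : ∀ A B : ℂ, ∑ j : Fin m, (A + B * z j.succ) = m * A + B * ∑ j : Fin m, z j.succ := by
      intro A B
      rw [Finset.sum_add_distrib, ← Finset.mul_sum]
      simp
    rw [← Finset.mul_sum, ← e]
    congr 1
    refine Finset.sum_congr rfl fun j _ => ?_
    ring
  have h6 : ∑ j, ((x j : ℂ) + τ * (y j : ℂ)) = z 0 + ∑ j : Fin m, z j.succ := by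
    rw [Fin.sum_univ_succ]
  rw [h5, h6]
  have key : ∀ e1 e2 s e3 e4 T P : ℂ, Complex.exp (e1 + e2 + s) = Complex.exp (e3 + e4) →
      Complex.exp e1 * T * (Complex.exp e2 * P) * Complex.exp s
        = Complex.exp e3 * (T * P * Complex.exp e4) := by
    intro e1 e2 s e3 e4 T P h
    rw [Complex.exp_add, Complex.exp_add, Complex.exp_add] at h
    linear_combination T * P * h
  apply key
  rw [Complex.exp_eq_exp_iff_exists_int]
  obtain ⟨r, hr⟩ := hkodd
  refine ⟨(r + 1) * m * (a - b) + l * a - m * b * 0, ?_⟩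
  simp only [hz]
  have hr' : (r : ℂ) = (k - 1) / 2 := by rw [hr]; push_cast; ring
  push_cast
  rw [hr']
  field_simp
  ring

/-- Translating the first particle by a lattice vector `a + bτ` multiplies the Laughlin
state by the unitary multiplier `e^{−2πik N_e b x₁}` of the degree-`kN_e` line bundle. -/
theorem stmt_11 (k Ne : ℕ) (hk : 1 ≤ k) (hkodd : Odd k) (hNe : 0 < Ne) (l : ℤ)
    (τ : ℂ) (hτ : 0 < τ.im) :
    ∀ (a b : ℤ) (x y : Fin Ne → ℝ),
      PsiLaughlin k Ne l τ (Function.update x ⟨0, hNe⟩ (x ⟨0, hNe⟩ + a))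
          (Function.update y ⟨0, hNe⟩ (y ⟨0, hNe⟩ + b)) =
        Complex.exp (-2 * Real.pi * Complex.I * (k : ℂ) * (Ne : ℂ) * (b : ℂ) *
            (x ⟨0, hNe⟩ : ℂ)) *
          PsiLaughlin k Ne l τ x y := by
  intro a b x y
  obtain ⟨m, rfl⟩ : ∃ m, Ne = m + 1 := ⟨Ne - 1, by omega⟩
  exact laughlin_shift k m hk hkodd l τ a b x y
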